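/- Let A ∈ ℍ^{n×n} be Hermitian and let i ∈ {1,…,n}. If the i-th row of A is replaced with a left linear combination of its other rows, i.e. with the row c_1 a_{i_1 .} + ⋯ + c_k a_{i_k .} where c_1,…,c_k ∈ ℍ and i_1,…,i_k ∈ {1,…,n} are indices all different from i, then both the i-th row determinant and the i-th column determinant of the resulting matrix vanish: rdet_i A_{i.}(c_1 a_{i_1 .} + ⋯ + c_k a_{i_k .}) = cdet_i A_{i.}(c_1 a_{i_1 .} + ⋯ + c_k a_{i_k .}) = 0. -/

import Mathlib

open Matrix
open scoped Classical

noncomputable section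

local notation "ℍ" => Quaternion ℝ

/-- The product of the entries of `A` along the `σ`-cycle of `j`, taken in forward
order starting at `j`:  `a_{j, σj} · a_{σj, σ²j} ⋯ a_{σ^{l-1}j, j}`. -/
def cycProd {n : ℕ} (A : Matrix (Fin n) (Fin n) ℍ) (σ : Equiv.Perm (Fin n)) (j : Fin n) : ℍ :=
  ((List.range (Function.minimalPeriod (⇑σ) j)).map
    fun t => A ((σ ^ t) j) ((σ ^ (t + 1)) j)).prod

/-- The minimal elements (leaders) of the `σ`-cycles not containing `i`, in
increasing order. -/
def othersList {n : ℕ} (σ : Equiv.Perm (Fin n)) (i : Fin n) : List (Fin n) :=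
  (Finset.univ.filter fun j =>
    ¬ σ.SameCycle i j ∧ ∀ t, σ.SameCycle j t → j ≤ t).sort (· ≤ ·)

/-- The `i`-th row determinant of a square quaternion matrix: the cycle containing
`i` is written first, starting at `i`; the remaining cycles follow, each starting at
its minimal element, ordered by increasing minimal elements; the sign `(-1)^{n-r}`
is the sign of the permutation. -/
def rdet {n : ℕ} (A : Matrix (Fin n) (Fin n) ℍ) (i : Fin n) : ℍ :=
  ∑ σ : Equiv.Perm (Fin n), ((Equiv.Perm.sign σ : ℤ) •
    (cycProd A σ i * ((othersList σ i).map (cycProd A σ)).prod))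

/-- The `j`-th column determinant of a square quaternion matrix (mirror convention:
the cycle containing `j` is written last, ending at `j`; the remaining cycles
precede it, ordered by decreasing minimal elements). -/
def cdet {n : ℕ} (A : Matrix (Fin n) (Fin n) ℍ) (j : Fin n) : ℍ :=
  ∑ σ : Equiv.Perm (Fin n), ((Equiv.Perm.sign σ : ℤ) •
    ((((othersList σ j).reverse.map (cycProd A σ)).prod) * cycProd A σ j))

/-- The determinant of a (Hermitian) quaternion matrix: all cycles ordered by
increasing minimal elements, each starting at its minimal element.  For Hermitian
matrices this is the common value of all row and column determinants. -/
def qdet {n : ℕ} (A : Matrix (Fin n) (Fin n) ℍ) : ℍ :=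
  ∑ σ : Equiv.Perm (Fin n), ((Equiv.Perm.sign σ : ℤ) •
    (((Finset.univ.filter fun j => ∀ t, σ.SameCycle j t → j ≤ t).sort (· ≤ ·)).map
      (cycProd A σ)).prod)

/-- The principal submatrix of `A` with rows and columns indexed by `β`. -/
def pSub {n : ℕ} (A : Matrix (Fin n) (Fin n) ℍ) (β : Finset (Fin n)) :
    Matrix (Fin β.card) (Fin β.card) ℍ :=
  fun a b => A ((β.orderIsoOfFin rfl) a) ((β.orderIsoOfFin rfl) b)

/-- `|A^β_β|`, the determinant of the principal submatrix indexed by `β`. -/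
def minorDet {n : ℕ} (A : Matrix (Fin n) (Fin n) ℍ) (β : Finset (Fin n)) : ℍ :=
  qdet (pSub A β)

/-- `cdet_i ((A)^β_β)` for `i ∈ β`. -/
def minorCdet {n : ℕ} (A : Matrix (Fin n) (Fin n) ℍ) (β : Finset (Fin n)) (i : Fin n) : ℍ :=
  if h : i ∈ β then cdet (pSub A β) ((β.orderIsoOfFin rfl).symm ⟨i, h⟩) else 0

/-- `rdet_j ((A)^α_α)` for `j ∈ α`. -/
def minorRdet {n : ℕ} (A : Matrix (Fin n) (Fin n) ℍ) (α : Finset (Fin n)) (j : Fin n) : ℍ :=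
  if h : j ∈ α then rdet (pSub A α) ((α.orderIsoOfFin rfl).symm ⟨j, h⟩) else 0

/-- The rank of a quaternion matrix: the dimension of its (left) row space. -/
def qrank {m n : ℕ} (A : Matrix (Fin m) (Fin n) ℍ) : ℕ :=
  Module.finrank ℍ (Submodule.span ℍ (Set.range A))

/-- `Ind A`: the smallest `k` with `rank A^{k+1} = rank A^k`. -/
def qindex {n : ℕ} (A : Matrix (Fin n) (Fin n) ℍ) : ℕ :=
  sInf {k | qrank (A ^ (k + 1)) = qrank (A ^ k)}

/-- `X` is the Moore–Penrose inverse of `A`. -/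
def IsMP {m n : ℕ} (A : Matrix (Fin m) (Fin n) ℍ) (X : Matrix (Fin n) (Fin m) ℍ) : Prop :=
  A * X * A = A ∧ X * A * X = X ∧ (A * X)ᴴ = A * X ∧ (X * A)ᴴ = X * A

/-- `X` is the Drazin inverse of `A`. -/
def IsDrazin {n : ℕ} (A X : Matrix (Fin n) (Fin n) ℍ) : Prop :=
  X * A * X = X ∧ A * X = X * A ∧ A ^ (qindex A + 1) * X = A ^ qindex A

/-- `X` is the W-weighted Drazin inverse of `A` with respect to `W`. -/
def IsWDrazin {m n : ℕ} (A : Matrix (Fin m) (Fin n) ℍ) (W : Matrix (Fin n) (Fin m) ℍ)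
    (X : Matrix (Fin m) (Fin n) ℍ) : Prop :=
  (A * W) ^ (max (qindex (A * W)) (qindex (W * A)) + 1) * X * W
      = (A * W) ^ max (qindex (A * W)) (qindex (W * A)) ∧
  X * W * A * W * X = X ∧ A * W * X = X * W * A

section CycleLemmas

variable {n : ℕ} {σ τ : Equiv.Perm (Fin n)} {i j k m : Fin n}

theorem isPeriodicPt_iff_pow_apply_eq (σ : Equiv.Perm (Fin n)) (t : ℕ) (j : Fin n) :
    Function.IsPeriodicPt σ t j ↔ (σ ^ t) j = j := by
  rw [Function.IsPeriodicPt, Function.IsFixedPt, Equiv.Perm.iterate_eq_pow]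

theorem minimalPeriod_perm_pos (σ : Equiv.Perm (Fin n)) (j : Fin n) :
    0 < Function.minimalPeriod σ j :=
  Function.IsPeriodicPt.minimalPeriod_pos (orderOf_pos σ)
    ((isPeriodicPt_iff_pow_apply_eq σ _ j).2 (by simp [pow_orderOf_eq_one]))

theorem pow_minimalPeriod_apply (σ : Equiv.Perm (Fin n)) (j : Fin n) :
    (σ ^ Function.minimalPeriod σ j) j = j :=
  (isPeriodicPt_iff_pow_apply_eq σ _ j).1 (Function.isPeriodicPt_minimalPeriod σ j)

theorem pow_apply_ne_of_lt_minimalPeriod {t : ℕ} (ht : 0 < t)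
    (htp : t < Function.minimalPeriod σ j) : (σ ^ t) j ≠ j := fun h =>
  Function.not_isPeriodicPt_of_pos_of_lt_minimalPeriod ht.ne' htp
    ((isPeriodicPt_iff_pow_apply_eq σ t j).2 h)

theorem sameCycle_iff_exists_pow : σ.SameCycle j k ↔ ∃ t : ℕ, (σ ^ t) j = k :=
  ⟨fun h => h.exists_nat_pow_eq, fun ⟨t, h⟩ => ⟨t, by simpa using h⟩⟩

/-- Points of the cycle of `j` are reached by a positive power at most the period. -/
theorem sameCycle_iff_exists_pow_le_minimalPeriod :
    σ.SameCycle j k ↔ ∃ t : ℕ, 0 < t ∧ t ≤ Function.minimalPeriod σ j ∧ (σ ^ t) j = k := by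
  refine ⟨fun h => ?_, fun ⟨t, _, _, h⟩ => sameCycle_iff_exists_pow.2 ⟨t, h⟩⟩
  obtain ⟨t, rfl⟩ := sameCycle_iff_exists_pow.1 h
  have hp := minimalPeriod_perm_pos σ j
  have hmod : (σ ^ (t % Function.minimalPeriod σ j)) j = (σ ^ t) j := by
    rw [← Equiv.Perm.iterate_eq_pow, ← Equiv.Perm.iterate_eq_pow,
      Function.iterate_mod_minimalPeriod_eq]
  rcases Nat.eq_zero_or_pos (t % Function.minimalPeriod σ j) with h0 | h0
  · refine ⟨_, hp, le_rfl, ?_⟩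
    rw [pow_minimalPeriod_apply, ← hmod, h0, pow_zero, Equiv.Perm.one_apply]
  · exact ⟨_, h0, (Nat.mod_lt _ hp).le, hmod⟩

theorem sameCycle_congr (h : ∀ t : ℕ, (τ ^ t) j = (σ ^ t) j) :
    τ.SameCycle j k ↔ σ.SameCycle j k := by
  simp only [sameCycle_iff_exists_pow, h]

theorem minimalPeriod_congr (h : ∀ t : ℕ, (τ ^ t) j = (σ ^ t) j) :
    Function.minimalPeriod τ j = Function.minimalPeriod σ j := by
  rw [Function.minimalPeriod_eq_minimalPeriod_iff]
  intro t
  rw [isPeriodicPt_iff_pow_apply_eq, isPeriodicPt_iff_pow_apply_eq, h]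

theorem pow_apply_congr_of_sameCycle (h : ∀ x, σ.SameCycle j x → τ x = σ x) (t : ℕ) :
    (τ ^ t) j = (σ ^ t) j := by
  induction t with
  | zero => simp
  | succ t ih =>
    rw [pow_succ', pow_succ', Equiv.Perm.mul_apply, Equiv.Perm.mul_apply, ih]
    exact h _ (sameCycle_iff_exists_pow.2 ⟨t, rfl⟩)

/-- The permutation obtained from `σ` by reversing its cycle through `m`. -/
def reverseCycle (σ : Equiv.Perm (Fin n)) (m : Fin n) : Equiv.Perm (Fin n) :=
  σ * (σ.cycleOf m)⁻¹ * (σ.cycleOf m)⁻¹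

theorem reverseCycle_apply_of_sameCycle (h : σ.SameCycle m j) :
    reverseCycle σ m j = σ⁻¹ j := by
  have h' : σ⁻¹.SameCycle m j := h.inv
  have h'' : σ⁻¹.SameCycle m (σ⁻¹ j) := Equiv.Perm.sameCycle_apply_right.2 h'
  rw [reverseCycle, Equiv.Perm.cycleOf_inv, Equiv.Perm.mul_apply, Equiv.Perm.mul_apply,
    h'.cycleOf_apply, h''.cycleOf_apply]
  simp

theorem reverseCycle_apply_of_not_sameCycle (h : ¬ σ.SameCycle m j) :
    reverseCycle σ m j = σ j := by
  have h' : ¬ σ⁻¹.SameCycle m j := fun h' => h h'.of_inv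
  rw [reverseCycle, Equiv.Perm.cycleOf_inv, Equiv.Perm.mul_apply, Equiv.Perm.mul_apply,
    Equiv.Perm.cycleOf_apply_of_not_sameCycle h', Equiv.Perm.cycleOf_apply_of_not_sameCycle h']

theorem sign_reverseCycle : Equiv.Perm.sign (reverseCycle σ m) = Equiv.Perm.sign σ := by
  simp [reverseCycle, mul_assoc, Int.units_mul_self]

theorem reverseCycle_pow_apply_of_not_sameCycle (h : ¬ σ.SameCycle m j) (t : ℕ) :
    (reverseCycle σ m ^ t) j = (σ ^ t) j :=
  pow_apply_congr_of_sameCycle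
    (fun _ hx => reverseCycle_apply_of_not_sameCycle fun hm => h (hm.trans hx.symm)) t

theorem reverseCycle_pow_apply_of_sameCycle (h : σ.SameCycle m j) (t : ℕ) :
    (reverseCycle σ m ^ t) j = (σ⁻¹ ^ t) j :=
  pow_apply_congr_of_sameCycle
    (fun _ hx => reverseCycle_apply_of_sameCycle (h.trans hx.of_inv)) t

theorem sameCycle_reverseCycle :
    (reverseCycle σ m).SameCycle j k ↔ σ.SameCycle j k := by
  by_cases h : σ.SameCycle m j
  · rw [sameCycle_congr (reverseCycle_pow_apply_of_sameCycle h), Equiv.Perm.sameCycle_inv]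
  · exact sameCycle_congr (reverseCycle_pow_apply_of_not_sameCycle h)

theorem reverseCycle_reverseCycle : reverseCycle (reverseCycle σ m) m = σ := by
  ext1 x
  by_cases h : σ.SameCycle m x
  · rw [reverseCycle_apply_of_sameCycle (sameCycle_reverseCycle.2 h), Equiv.Perm.inv_eq_iff_eq,
      reverseCycle_apply_of_sameCycle (Equiv.Perm.sameCycle_apply_right.2 h)]
    simp
  · rw [reverseCycle_apply_of_not_sameCycle (fun h' => h (sameCycle_reverseCycle.1 h')),
      reverseCycle_apply_of_not_sameCycle h]

theorem sum_comp_reverseCycle {M : Type*} [AddCommMonoid M] (m : Fin n)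
    (f : Equiv.Perm (Fin n) → M) : ∑ σ, f (reverseCycle σ m) = ∑ σ, f σ :=
  Equiv.sum_comp ⟨fun σ => reverseCycle σ m, fun σ => reverseCycle σ m,
    fun _ => reverseCycle_reverseCycle, fun _ => reverseCycle_reverseCycle⟩ f

theorem othersList_reverseCycle : othersList (reverseCycle σ m) i = othersList σ i := by
  simp only [othersList, sameCycle_reverseCycle]

theorem mem_othersList : j ∈ othersList σ i ↔
    ¬ σ.SameCycle i j ∧ ∀ t, σ.SameCycle j t → j ≤ t := by
  simp [othersList]

theorem nodup_othersList : (othersList σ i).Nodup := Finset.sort_nodup _ _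

end CycleLemmas

section CycProd

variable {n : ℕ} {A B : Matrix (Fin n) (Fin n) ℍ} {σ τ : Equiv.Perm (Fin n)} {i j k m : Fin n}

theorem cycProd_congr (h : ∀ t : ℕ, (τ ^ t) j = (σ ^ t) j)
    (hAB : ∀ x, σ.SameCycle j x → A x = B x) : cycProd A τ j = cycProd B σ j := by
  rw [cycProd, cycProd, minimalPeriod_congr h]
  simp only [h]
  congr 1
  refine List.map_congr_left fun t _ => ?_
  rw [hAB _ (sameCycle_iff_exists_pow.2 ⟨t, rfl⟩)]

theorem cycProd_reverseCycle_of_not_sameCycle (h : ¬ σ.SameCycle m j) :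
    cycProd A (reverseCycle σ m) j = cycProd A σ j :=
  cycProd_congr (reverseCycle_pow_apply_of_not_sameCycle h) fun _ _ => rfl

theorem star_list_prod_map_range (f : ℕ → ℍ) (p : ℕ) :
    star ((List.range p).map f).prod =
      ((List.range p).map fun t => star (f (p - 1 - t))).prod := by
  induction p with
  | zero => simp
  | succ p ih =>
    rw [List.prod_range_succ, star_mul, ih, List.prod_range_succ']
    simp only [Nat.add_sub_cancel, Nat.sub_zero]
    congr 3
    funext t
    congr 2
    omega

theorem cycProd_reverseCycle_self (hA : Aᴴ = A) :
    cycProd A (reverseCycle σ m) m = star (cycProd A σ m) := by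
  have h := reverseCycle_pow_apply_of_sameCycle (Equiv.Perm.SameCycle.refl σ m)
  have hp : Function.minimalPeriod (reverseCycle σ m) m = Function.minimalPeriod σ m := by
    rw [Function.minimalPeriod_eq_minimalPeriod_iff]
    intro t
    rw [isPeriodicPt_iff_pow_apply_eq, isPeriodicPt_iff_pow_apply_eq, h, inv_pow,
      Equiv.Perm.inv_eq_iff_eq, eq_comm]
  have hinv : ∀ t ≤ Function.minimalPeriod σ m,
      (σ⁻¹ ^ t) m = (σ ^ (Function.minimalPeriod σ m - t)) m := by
    intro t ht
    rw [inv_pow, Equiv.Perm.inv_eq_iff_eq, ← Equiv.Perm.mul_apply, ← pow_add,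
      Nat.add_sub_cancel' ht, pow_minimalPeriod_apply]
  rw [cycProd, cycProd, star_list_prod_map_range, hp]
  congr 1
  refine List.map_congr_left fun t ht => ?_
  rw [List.mem_range] at ht
  rw [h, h, hinv t ht.le, hinv (t + 1) ht, ← Matrix.conjTranspose_apply, hA]
  congr 3 <;> omega

theorem re_cycProd_apply (A : Matrix (Fin n) (Fin n) ℍ) (σ : Equiv.Perm (Fin n)) (j : Fin n) :
    (cycProd A σ (σ j)).re = (cycProd A σ j).re := by
  have hpos := minimalPeriod_perm_pos σ j
  have hp : Function.minimalPeriod σ (σ j) = Function.minimalPeriod σ j :=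
    Function.minimalPeriod_apply (Function.minimalPeriod_pos_iff_mem_periodicPts.1 hpos)
  have hpow : ∀ t : ℕ, (σ ^ t) (σ j) = (σ ^ (t + 1)) j := fun t => by
    rw [pow_succ, Equiv.Perm.mul_apply]
  obtain ⟨p, hp'⟩ := Nat.exists_eq_succ_of_ne_zero hpos.ne'
  have hend : (σ ^ (p + 1)) j = j := by rw [← Nat.succ_eq_add_one, ← hp', pow_minimalPeriod_apply]
  have hend' : (σ ^ (p + 1 + 1)) j = σ j := by
    rw [pow_succ', Equiv.Perm.mul_apply, hend]
  rw [cycProd, cycProd, hp, hp', Nat.succ_eq_add_one, List.prod_range_succ, List.prod_range_succ']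
  simp only [hpow, hend, hend', pow_zero, Equiv.Perm.one_apply, zero_add, pow_one]
  simp only [Quaternion.re_mul]
  ring

theorem re_cycProd_eq_of_sameCycle (h : σ.SameCycle j k) :
    (cycProd A σ k).re = (cycProd A σ j).re := by
  obtain ⟨t, rfl⟩ := sameCycle_iff_exists_pow.1 h
  clear h
  induction t with
  | zero => simp
  | succ t ih => rw [pow_succ', Equiv.Perm.mul_apply, re_cycProd_apply, ih]

/-- The cycle product at `j` without its first factor. -/
def cycTail (A : Matrix (Fin n) (Fin n) ℍ) (σ : Equiv.Perm (Fin n)) (j : Fin n) : ℍ :=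
  ((List.range (Function.minimalPeriod σ j - 1)).map
    fun t => A ((σ ^ (t + 1)) j) ((σ ^ (t + 2)) j)).prod

theorem cycProd_updateRow_self (A : Matrix (Fin n) (Fin n) ℍ) (b : Fin n → ℍ)
    (σ : Equiv.Perm (Fin n)) (i : Fin n) :
    cycProd (A.updateRow i b) σ i = b (σ i) * cycTail A σ i := by
  have hpos := minimalPeriod_perm_pos σ i
  obtain ⟨p, hp⟩ := Nat.exists_eq_succ_of_ne_zero hpos.ne'
  rw [cycProd, cycTail, hp, Nat.succ_eq_add_one, List.prod_range_succ']
  simp only [pow_zero, Equiv.Perm.one_apply, zero_add, pow_one, Matrix.updateRow_self,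
    Nat.add_sub_cancel]
  congr 2
  refine List.map_congr_left fun t ht => ?_
  rw [List.mem_range] at ht
  rw [Matrix.updateRow_ne (pow_apply_ne_of_lt_minimalPeriod (by omega) (by omega))]

theorem cycProd_updateRow_of_not_sameCycle (b : Fin n → ℍ) (h : ¬ σ.SameCycle i j) :
    cycProd (A.updateRow i b) σ j = cycProd A σ j :=
  cycProd_congr (fun _ => rfl) fun x hx =>
    Matrix.updateRow_ne (by rintro rfl; exact h hx.symm)

end CycProd

section Averaging

variable {n : ℕ} {A : Matrix (Fin n) (Fin n) ℍ} {σ : Equiv.Perm (Fin n)} {i j k m : Fin n}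

theorem list_prod_map_add_prod_map_eq {α R : Type*} [Semiring R] {L : List α} (hL : L.Nodup)
    {m : α} (hm : m ∈ L) {f g h : α → R} (hg : ∀ j ∈ L, j ≠ m → g j = f j)
    (hh : ∀ j ∈ L, j ≠ m → h j = f j) (hs : f m + g m = h m + h m) :
    (L.map f).prod + (L.map g).prod = (L.map h).prod + (L.map h).prod := by
  obtain ⟨s, t, rfl⟩ := List.append_of_mem hm
  have hms : ∀ j ∈ s, j ≠ m := by
    rintro j hj rfl
    exact (List.nodup_append.1 hL).2.2 j hj j (by simp) rfl
  have hmt : ∀ j ∈ t, j ≠ m := by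
    rintro j hj rfl
    exact (List.nodup_cons.1 (List.nodup_append.1 hL).2.1).1 hj
  have key : ∀ u : α → R, (∀ j ∈ s ++ m :: t, j ≠ m → u j = f j) →
      ((s ++ m :: t).map u).prod = (s.map f).prod * (u m * (t.map f).prod) := by
    intro u hu
    rw [List.map_append, List.map_cons, List.prod_append, List.prod_cons,
      List.map_congr_left fun j hj => hu j (by simp [hj]) (hms j hj),
      List.map_congr_left fun j hj => hu j (by simp [hj]) (hmt j hj)]
  rw [key f fun _ _ _ => rfl, key g hg, key h hh, ← mul_add, ← add_mul, hs, add_mul, mul_add]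

theorem eq_of_mem_othersList_of_sameCycle (hj : j ∈ othersList σ i) (hm : m ∈ othersList σ i)
    (h : σ.SameCycle m j) : j = m :=
  le_antisymm ((mem_othersList.1 hj).2 m h.symm) ((mem_othersList.1 hm).2 j h)

/-- In a signed sum over permutations, the cycles avoiding `i` of a Hermitian matrix contribute
only through the real parts of their products. -/
theorem sum_prod_map_cycProd_eq_sum_prod_map_re (hA : Aᴴ = A) (i : Fin n)
    (Φ : Equiv.Perm (Fin n) → ℍ →+ ℍ) (ℓ : Equiv.Perm (Fin n) → List (Fin n))
    (hΦ : ∀ σ m, ¬ σ.SameCycle i m → Φ (reverseCycle σ m) = Φ σ)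
    (hℓ : ∀ σ m, ℓ (reverseCycle σ m) = ℓ σ) (hnodup : ∀ σ, (ℓ σ).Nodup)
    (hmem : ∀ σ, ∀ j ∈ ℓ σ, j ∈ othersList σ i) :
    ∑ σ, Φ σ ((ℓ σ).map (cycProd A σ)).prod =
      ∑ σ, Φ σ ((ℓ σ).map fun j => ((cycProd A σ j).re : ℍ)).prod := by
  let P : ℕ → Equiv.Perm (Fin n) → Fin n → ℍ := fun r σ j =>
    if (j : ℕ) < r then ((cycProd A σ j).re : ℍ) else cycProd A σ j
  have hPre : ∀ r, ∀ σ (m : Fin n), ∀ j, j ∈ othersList σ i → m ∈ othersList σ i → j ≠ m →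
      P r (reverseCycle σ m) j = P r σ j := by
    intro r σ m j hj hm hjm
    have hnot : ¬ σ.SameCycle m j := fun h => hjm (eq_of_mem_othersList_of_sameCycle hj hm h)
    simp only [P, cycProd_reverseCycle_of_not_sameCycle hnot]
  have hstep : ∀ m : Fin n, ∑ σ, Φ σ ((ℓ σ).map (P m σ)).prod =
      ∑ σ, Φ σ ((ℓ σ).map (P (m + 1) σ)).prod := by
    intro m
    have hsucc : ∀ σ, ∀ j, j ≠ m → P (m + 1) σ j = P m σ j := by
      intro σ j hj
      have : ((j : ℕ) < m + 1) ↔ (j : ℕ) < m := by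
        have := Fin.val_ne_of_ne hj
        omega
      simp only [P, this]
    have hpt : ∀ σ, Φ σ ((ℓ σ).map (P m σ)).prod +
        Φ (reverseCycle σ m) ((ℓ (reverseCycle σ m)).map (P m (reverseCycle σ m))).prod =
        Φ σ ((ℓ σ).map (P (m + 1) σ)).prod +
        Φ (reverseCycle σ m)
          ((ℓ (reverseCycle σ m)).map (P (m + 1) (reverseCycle σ m))).prod := by
      intro σ
      by_cases hm : m ∈ ℓ σ
      · have hm' := hmem σ m hm
        have hP1 : (ℓ σ).map (P (m + 1) (reverseCycle σ m)) = (ℓ σ).map (P (m + 1) σ) := by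
          refine List.map_congr_left fun j hj => ?_
          rcases eq_or_ne j m with rfl | hjm
          · simp [P, cycProd_reverseCycle_self hA]
          · exact hPre _ σ m j (hmem σ j hj) hm' hjm
        rw [hℓ, hΦ σ m (mem_othersList.1 hm').1, ← map_add, ← map_add, hP1]
        congr 1
        refine list_prod_map_add_prod_map_eq (hnodup σ) hm
          (fun j hj hjm => hPre _ σ m j (hmem σ j hj) hm' hjm)
          (fun j _ hjm => hsucc σ j hjm) ?_
        simp only [P, lt_irrefl, if_false, Nat.lt_succ_self, if_true,
          cycProd_reverseCycle_self hA, Quaternion.self_add_star]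
        rw [← two_mul]
      · have hL : ∀ τ, (ℓ σ).map (P (m + 1) τ) = (ℓ σ).map (P m τ) := fun τ =>
          List.map_congr_left fun j hj => hsucc τ j (by rintro rfl; exact hm hj)
        rw [hℓ, hL, hL]
    have hsum := Finset.sum_congr (rfl : Finset.univ = Finset.univ) fun σ _ => hpt σ
    rw [Finset.sum_add_distrib, Finset.sum_add_distrib,
      sum_comp_reverseCycle m fun σ => Φ σ ((ℓ σ).map (P m σ)).prod,
      sum_comp_reverseCycle m fun σ => Φ σ ((ℓ σ).map (P (m + 1) σ)).prod,
      ← two_smul ℝ, ← two_smul ℝ] at hsum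
    exact smul_right_injective ℍ two_ne_zero hsum
  have hall : ∀ r ≤ n, ∑ σ, Φ σ ((ℓ σ).map (P 0 σ)).prod =
      ∑ σ, Φ σ ((ℓ σ).map (P r σ)).prod := by
    intro r hr
    induction r with
    | zero => rfl
    | succ r ih => exact (ih (by omega)).trans (hstep ⟨r, hr⟩)
  simpa [P] using hall n le_rfl

/-- The product of the real parts of the cycle products over all cycles avoiding `i`. -/
def othersRe (A : Matrix (Fin n) (Fin n) ℍ) (σ : Equiv.Perm (Fin n)) (i : Fin n) : ℝ :=
  ∏ j with ¬ σ.SameCycle i j ∧ ∀ t, σ.SameCycle j t → j ≤ t, (cycProd A σ j).re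

theorem prod_map_re_othersList :
    ((othersList σ i).map fun j => ((cycProd A σ j).re : ℍ)).prod = (othersRe A σ i : ℍ) := by
  have h : ((othersList σ i).map fun j => (cycProd A σ j).re).prod = othersRe A σ i := by
    rw [othersRe, Finset.prod, ← Finset.sort_eq _ (· ≤ ·), Multiset.map_coe, Multiset.prod_coe]
    rfl
  rw [← h]
  refine Eq.trans ?_ (map_list_prod (algebraMap ℝ ℍ) _).symm
  rw [List.map_map]
  rfl

theorem prod_map_re_reverse_othersList :
    ((othersList σ i).reverse.map fun j => ((cycProd A σ j).re : ℍ)).prod =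
      (othersRe A σ i : ℍ) := by
  rw [← prod_map_re_othersList]
  refine List.Perm.prod_eq' ((List.reverse_perm _).map _)
    (List.pairwise_map.2 (List.pairwise_of_forall fun _ _ => ?_))
  exact Quaternion.coe_commute _ _

theorem rdet_updateRow_eq_sum (hA : Aᴴ = A) (i : Fin n) (b : Fin n → ℍ) :
    rdet (A.updateRow i b) i = ∑ σ : Equiv.Perm (Fin n), (Equiv.Perm.sign σ : ℤ) •
      othersRe A σ i • (b (σ i) * cycTail A σ i) := by
  have h := sum_prod_map_cycProd_eq_sum_prod_map_re hA i
    (fun σ => (Equiv.Perm.sign σ : ℤ) • AddMonoidHom.mulLeft (cycProd (A.updateRow i b) σ i))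
    (fun σ => othersList σ i)
    (fun σ m hm => by
      rw [sign_reverseCycle, cycProd_reverseCycle_of_not_sameCycle fun h => hm h.symm])
    (fun _ _ => othersList_reverseCycle) (fun _ => nodup_othersList) (fun _ _ h => h)
  simp only [AddMonoidHom.smul_apply, AddMonoidHom.coe_mulLeft, prod_map_re_othersList] at h
  rw [rdet]
  refine Eq.trans (Finset.sum_congr rfl fun σ _ => ?_)
    (h.trans (Finset.sum_congr rfl fun σ _ => ?_))
  · rw [List.map_congr_left fun j hj =>
      cycProd_updateRow_of_not_sameCycle b (mem_othersList.1 hj).1]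
  · rw [Quaternion.mul_coe_eq_smul, cycProd_updateRow_self]

theorem cdet_updateRow_eq_sum (hA : Aᴴ = A) (i : Fin n) (b : Fin n → ℍ) :
    cdet (A.updateRow i b) i = ∑ σ : Equiv.Perm (Fin n), (Equiv.Perm.sign σ : ℤ) •
      othersRe A σ i • (b (σ i) * cycTail A σ i) := by
  have h := sum_prod_map_cycProd_eq_sum_prod_map_re hA i
    (fun σ => (Equiv.Perm.sign σ : ℤ) • AddMonoidHom.mulRight (cycProd (A.updateRow i b) σ i))
    (fun σ => (othersList σ i).reverse)
    (fun σ m hm => by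
      rw [sign_reverseCycle, cycProd_reverseCycle_of_not_sameCycle fun h => hm h.symm])
    (fun _ _ => by rw [othersList_reverseCycle])
    (fun _ => List.nodup_reverse.2 nodup_othersList) (fun _ _ h => List.mem_reverse.1 h)
  simp only [AddMonoidHom.smul_apply, AddMonoidHom.mulRight_apply,
    prod_map_re_reverse_othersList] at h
  rw [cdet]
  refine Eq.trans (Finset.sum_congr rfl fun σ _ => ?_)
    (h.trans (Finset.sum_congr rfl fun σ _ => ?_))
  · rw [List.map_congr_left fun j hj =>
      cycProd_updateRow_of_not_sameCycle b (mem_othersList.1 (List.mem_reverse.1 hj)).1]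
  · rw [Quaternion.coe_mul_eq_smul, cycProd_updateRow_self]

end Averaging

section MulSwap

variable {n : ℕ} {A : Matrix (Fin n) (Fin n) ℍ} {σ : Equiv.Perm (Fin n)} {i j k : Fin n}

theorem mul_swap_pow_apply_left (h : ¬ σ.SameCycle i k) {t : ℕ} (ht : 0 < t)
    (htp : t ≤ Function.minimalPeriod σ k) : ((σ * Equiv.swap i k) ^ t) i = (σ ^ t) k := by
  induction t with
  | zero => omega
  | succ t ih =>
    rcases Nat.eq_zero_or_pos t with rfl | h0
    · simp
    · have hi : (σ ^ t) k ≠ i := fun h' => h (sameCycle_iff_exists_pow.2 ⟨t, h'⟩).symm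
      have hk : (σ ^ t) k ≠ k := pow_apply_ne_of_lt_minimalPeriod h0 (by omega)
      rw [pow_succ', Equiv.Perm.mul_apply, ih h0 (by omega), Equiv.Perm.mul_apply,
        Equiv.swap_apply_of_ne_of_ne hi hk, pow_succ', Equiv.Perm.mul_apply]

theorem mul_swap_pow_add_apply_left (h : ¬ σ.SameCycle i k) {s : ℕ} (hs : 0 < s)
    (hsq : s ≤ Function.minimalPeriod σ i) :
    ((σ * Equiv.swap i k) ^ (Function.minimalPeriod σ k + s)) i = (σ ^ s) i := by
  have hk : ((σ * Equiv.swap i k) ^ Function.minimalPeriod σ k) i = k := by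
    rw [mul_swap_pow_apply_left h (minimalPeriod_perm_pos σ k) le_rfl, pow_minimalPeriod_apply]
  rw [add_comm, pow_add, Equiv.Perm.mul_apply, hk, Equiv.swap_comm]
  exact mul_swap_pow_apply_left (fun h' => h h'.symm) hs hsq

theorem minimalPeriod_mul_swap (h : ¬ σ.SameCycle i k) :
    Function.minimalPeriod (σ * Equiv.swap i k) i =
      Function.minimalPeriod σ k + Function.minimalPeriod σ i := by
  have hq := minimalPeriod_perm_pos σ i
  have hm := minimalPeriod_perm_pos (σ * Equiv.swap i k) i
  have hmi := pow_minimalPeriod_apply (σ * Equiv.swap i k) i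
  refine le_antisymm (Function.IsPeriodicPt.minimalPeriod_le (by omega) ?_) ?_
  · rw [isPeriodicPt_iff_pow_apply_eq, mul_swap_pow_add_apply_left h hq le_rfl,
      pow_minimalPeriod_apply]
  · by_contra! hlt
    rcases le_or_gt (Function.minimalPeriod (σ * Equiv.swap i k) i)
      (Function.minimalPeriod σ k) with hle | hgt
    · rw [mul_swap_pow_apply_left h hm hle] at hmi
      exact h (sameCycle_iff_exists_pow.2 ⟨_, hmi⟩).symm
    · obtain ⟨s, hs⟩ := Nat.exists_eq_add_of_lt hgt
      rw [hs, add_assoc, mul_swap_pow_add_apply_left h (by omega) (by omega)] at hmi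
      exact pow_apply_ne_of_lt_minimalPeriod (by omega) (by omega) hmi

theorem sameCycle_mul_swap_of_not_sameCycle (h : ¬ σ.SameCycle i k) :
    (σ * Equiv.swap i k).SameCycle i k :=
  sameCycle_iff_exists_pow.2 ⟨_, by
    rw [mul_swap_pow_apply_left h (minimalPeriod_perm_pos σ k) le_rfl, pow_minimalPeriod_apply]⟩

theorem not_sameCycle_mul_swap_of_sameCycle (hik : k ≠ i) (h : σ.SameCycle i k) :
    ¬ (σ * Equiv.swap i k).SameCycle i k := by
  obtain ⟨p, hp0, hpq, hp⟩ := sameCycle_iff_exists_pow_le_minimalPeriod.1 h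
  have hplt : p < Function.minimalPeriod σ i := lt_of_le_of_ne hpq (by
    rintro rfl
    exact hik (by rw [← hp, pow_minimalPeriod_apply]))
  have hinj : ∀ r, 0 < r → r < p → (σ ^ r) i ≠ k := by
    intro r hr0 hrp hrk
    have := (Function.iterate_eq_iterate_iff_of_lt_minimalPeriod (hrp.trans hplt) hplt).1
      (by rw [Equiv.Perm.iterate_eq_pow, Equiv.Perm.iterate_eq_pow, hrk, hp])
    omega
  have horbit : ∀ t : ℕ, ∃ r, 0 < r ∧ r ≤ p ∧ ((σ * Equiv.swap i k) ^ t) k = (σ ^ r) i := by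
    intro t
    induction t with
    | zero => exact ⟨p, hp0, le_rfl, by simp [hp]⟩
    | succ t ih =>
      obtain ⟨r, hr0, hrp, hr⟩ := ih
      rw [pow_succ', Equiv.Perm.mul_apply, hr, Equiv.Perm.mul_apply]
      rcases hrp.lt_or_eq with hlt | rfl
      · refine ⟨r + 1, by omega, hlt, ?_⟩
        rw [Equiv.swap_apply_of_ne_of_ne
          (pow_apply_ne_of_lt_minimalPeriod hr0 (hlt.trans hplt)) (hinj r hr0 hlt),
          pow_succ', Equiv.Perm.mul_apply]
      · exact ⟨1, one_pos, hp0, by simp [hp]⟩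
  intro hc
  obtain ⟨t, ht⟩ := sameCycle_iff_exists_pow.1 hc.symm
  obtain ⟨r, hr0, hrp, hr⟩ := horbit t
  exact pow_apply_ne_of_lt_minimalPeriod hr0 (hrp.trans_lt hplt) (hr.symm.trans ht)

theorem sameCycle_mul_swap_iff (hik : k ≠ i) :
    (σ * Equiv.swap i k).SameCycle i k ↔ ¬ σ.SameCycle i k :=
  ⟨fun h h' => not_sameCycle_mul_swap_of_sameCycle hik h' h,
    sameCycle_mul_swap_of_not_sameCycle⟩

theorem mul_swap_pow_apply_of_not_sameCycle (hi : ¬ σ.SameCycle i j) (hk : ¬ σ.SameCycle k j)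
    (t : ℕ) : ((σ * Equiv.swap i k) ^ t) j = (σ ^ t) j :=
  pow_apply_congr_of_sameCycle (fun x hx => by
    rw [Equiv.Perm.mul_apply, Equiv.swap_apply_of_ne_of_ne]
    · rintro rfl; exact hi hx.symm
    · rintro rfl; exact hk hx.symm) t

theorem sameCycle_mul_swap_left_iff (h : ¬ σ.SameCycle i k) :
    (σ * Equiv.swap i k).SameCycle i j ↔ σ.SameCycle i j ∨ σ.SameCycle k j := by
  constructor
  · intro hj
    by_contra! hn
    exact hn.1 ((sameCycle_congr (mul_swap_pow_apply_of_not_sameCycle hn.1 hn.2)).1 hj.symm).symm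
  · rintro (hj | hj)
    · obtain ⟨t, ht0, ht, rfl⟩ := sameCycle_iff_exists_pow_le_minimalPeriod.1 hj
      exact sameCycle_iff_exists_pow.2 ⟨_, mul_swap_pow_add_apply_left h ht0 ht⟩
    · obtain ⟨t, ht0, ht, rfl⟩ := sameCycle_iff_exists_pow_le_minimalPeriod.1 hj
      exact sameCycle_iff_exists_pow.2 ⟨_, mul_swap_pow_apply_left h ht0 ht⟩

theorem othersRe_eq_mul_othersRe_mul_swap (h : ¬ σ.SameCycle i k) :
    othersRe A σ i = (cycProd A σ k).re * othersRe A (σ * Equiv.swap i k) i := by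
  obtain ⟨l, hl, hlmin⟩ := Finset.exists_min_image
    (Finset.univ.filter fun j => σ.SameCycle k j) id
    ⟨k, by simp [Equiv.Perm.SameCycle.refl]⟩
  simp only [Finset.mem_filter, Finset.mem_univ, true_and, id] at hl hlmin
  have hil : ¬ σ.SameCycle i l := fun h' => h (h'.trans hl.symm)
  have hset : (Finset.univ.filter fun j => ¬ σ.SameCycle i j ∧ ∀ t, σ.SameCycle j t → j ≤ t) =
      insert l (Finset.univ.filter fun j => ¬ (σ * Equiv.swap i k).SameCycle i j ∧
        ∀ t, (σ * Equiv.swap i k).SameCycle j t → j ≤ t) := by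
    ext j
    simp only [Finset.mem_filter, Finset.mem_univ, true_and, Finset.mem_insert,
      sameCycle_mul_swap_left_iff h, not_or]
    constructor
    · rintro ⟨hi, hmin⟩
      by_cases hk : σ.SameCycle k j
      · exact Or.inl (le_antisymm (hmin l (hk.symm.trans hl)) (hlmin j hk))
      · exact Or.inr ⟨⟨hi, hk⟩, fun t ht => hmin t
          ((sameCycle_congr (mul_swap_pow_apply_of_not_sameCycle hi hk)).1 ht)⟩
    · rintro (rfl | ⟨⟨hi, hk⟩, hmin⟩)
      · exact ⟨hil, fun t ht => hlmin t (hl.trans ht)⟩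
      · exact ⟨hi, fun t ht => hmin t
          ((sameCycle_congr (mul_swap_pow_apply_of_not_sameCycle hi hk)).2 ht)⟩
  rw [othersRe, hset, Finset.prod_insert, re_cycProd_eq_of_sameCycle hl, othersRe]
  · congr 1
    refine Finset.prod_congr rfl fun j hj => ?_
    simp only [Finset.mem_filter, Finset.mem_univ, true_and, sameCycle_mul_swap_left_iff h,
      not_or] at hj
    rw [cycProd_congr (mul_swap_pow_apply_of_not_sameCycle hj.1.1 hj.1.2) fun _ _ => rfl]
  · simp [sameCycle_mul_swap_left_iff h, hl]

theorem cycProd_updateRow_mul_swap (h : ¬ σ.SameCycle i k) :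
    cycProd (A.updateRow i (A k)) (σ * Equiv.swap i k) i =
      cycProd A σ k * cycProd (A.updateRow i (A k)) σ i := by
  have hp := minimalPeriod_perm_pos σ k
  have hik : k ≠ i := by rintro rfl; exact h (Equiv.Perm.SameCycle.refl σ k)
  rw [cycProd, minimalPeriod_mul_swap h, List.range_add, List.map_append, List.prod_append,
    List.map_map, ← cycProd_updateRow_of_not_sameCycle (A k) h, cycProd, cycProd]
  congr 2
  · refine List.map_congr_left fun t ht => ?_
    rw [List.mem_range] at ht
    rw [mul_swap_pow_apply_left h (by omega : 0 < t + 1) ht]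
    rcases Nat.eq_zero_or_pos t with rfl | h0
    · simp [Matrix.updateRow_ne hik]
    · rw [mul_swap_pow_apply_left h h0 ht.le]
  · refine List.map_congr_left fun t ht => ?_
    rw [List.mem_range] at ht
    rw [Function.comp_apply, add_assoc,
      mul_swap_pow_add_apply_left h (by omega : 0 < t + 1) ht]
    rcases Nat.eq_zero_or_pos t with rfl | h0
    · rw [add_zero, mul_swap_pow_apply_left h hp le_rfl, pow_minimalPeriod_apply]
      simp [Matrix.updateRow_ne hik]
    · rw [mul_swap_pow_add_apply_left h h0 ht.le]

theorem sum_sign_smul_othersRe_smul_eq_zero (hA : Aᴴ = A) (hik : k ≠ i) :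
    ∑ σ : Equiv.Perm (Fin n), (Equiv.Perm.sign σ : ℤ) •
      othersRe A σ i • (A k (σ i) * cycTail A σ i) = 0 := by
  let W : Equiv.Perm (Fin n) → ℍ := fun σ => (Equiv.Perm.sign σ : ℤ) •
    othersRe A σ i • cycProd (A.updateRow i (A k)) σ i
  let U : Equiv.Perm (Fin n) → ℍ := fun σ =>
    if σ.SameCycle i k then 0 else W (σ * Equiv.swap i k)
  let V : Equiv.Perm (Fin n) → ℍ := fun σ => if σ.SameCycle i k then 0 else W σ
  have hrev : ∀ σ : Equiv.Perm (Fin n), ¬ σ.SameCycle i k →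
      othersRe A (reverseCycle σ k * Equiv.swap i k) i = othersRe A (σ * Equiv.swap i k) i := by
    intro σ h
    have h' : ¬ (reverseCycle σ k).SameCycle i k := fun h' => h (sameCycle_reverseCycle.1 h')
    have hnot : ∀ j, ¬ (σ * Equiv.swap i k).SameCycle i j →
        ∀ t : ℕ, ((reverseCycle σ k * Equiv.swap i k) ^ t) j =
          ((σ * Equiv.swap i k) ^ t) j := by
      intro j hj t
      rw [sameCycle_mul_swap_left_iff h, not_or] at hj
      rw [mul_swap_pow_apply_of_not_sameCycle (fun hc => hj.1 (sameCycle_reverseCycle.1 hc))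
        (fun hc => hj.2 (sameCycle_reverseCycle.1 hc)),
        reverseCycle_pow_apply_of_not_sameCycle hj.2,
        mul_swap_pow_apply_of_not_sameCycle hj.1 hj.2]
    have hleft : ∀ j, (reverseCycle σ k * Equiv.swap i k).SameCycle i j ↔
        (σ * Equiv.swap i k).SameCycle i j := by
      intro j
      rw [sameCycle_mul_swap_left_iff h, sameCycle_mul_swap_left_iff h', sameCycle_reverseCycle,
        sameCycle_reverseCycle]
    rw [othersRe, othersRe]
    refine Finset.prod_congr (Finset.filter_congr fun j _ => ?_) fun j hj => ?_
    · rw [hleft]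
      exact and_congr_right fun hj => by simp only [sameCycle_congr (hnot j hj)]
    · rw [Finset.mem_filter] at hj
      rw [cycProd_congr (hnot j hj.2.1) fun _ _ => rfl]
  have hpt : ∀ σ, U σ + U (reverseCycle σ k) + (V σ + V σ) = 0 := by
    intro σ
    by_cases h : σ.SameCycle i k
    · simp [U, V, h, sameCycle_reverseCycle]
    · have h' : ¬ (reverseCycle σ k).SameCycle i k := fun h' => h (sameCycle_reverseCycle.1 h')
      simp only [U, V, if_neg h, if_neg h', W]
      rw [hrev σ h, cycProd_updateRow_mul_swap h, cycProd_updateRow_mul_swap h',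
        cycProd_reverseCycle_self hA,
        cycProd_reverseCycle_of_not_sameCycle fun hc => h hc.symm,
        othersRe_eq_mul_othersRe_mul_swap h, Equiv.Perm.sign_mul, Equiv.Perm.sign_mul,
        sign_reverseCycle, Equiv.Perm.sign_swap hik.symm]
      rw [← smul_add, ← smul_add, ← add_mul, Quaternion.self_add_star]
      generalize cycProd (A.updateRow i (A k)) σ i = x
      generalize (cycProd A σ k).re = r
      generalize othersRe A (σ * Equiv.swap i k) i = s
      have : (2 * (r : ℍ)) * x = (2 * r) • x := by
        rw [← Quaternion.coe_mul_eq_smul]; push_cast; rfl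
      rw [this]
      push_cast
      module
  have hUV : ∑ σ, U σ + ∑ σ, V σ = ∑ σ, W σ := by
    rw [← Equiv.sum_comp (Equiv.mulRight (Equiv.swap i k)) U, ← Finset.sum_add_distrib]
    refine Finset.sum_congr rfl fun σ _ => ?_
    simp only [U, V, Equiv.coe_mulRight, mul_assoc, Equiv.swap_mul_self, mul_one,
      sameCycle_mul_swap_iff hik]
    by_cases h : σ.SameCycle i k <;> simp [h]
  have hsum := Finset.sum_congr (rfl : Finset.univ = Finset.univ) fun σ _ => hpt σ
  rw [Finset.sum_add_distrib, Finset.sum_add_distrib, Finset.sum_add_distrib,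
    sum_comp_reverseCycle k U, Finset.sum_const_zero, add_add_add_comm, hUV, ← two_smul ℝ] at hsum
  simpa only [W, cycProd_updateRow_self] using (smul_eq_zero.1 hsum).resolve_left two_ne_zero

end MulSwap

theorem hermitian_rdet_cdet_row_lin_comb_eq_zero {n : ℕ} (A : Matrix (Fin n) (Fin n) ℍ)
    (hA : Aᴴ = A) (i : Fin n) (k : ℕ) (c : Fin k → ℍ) (idx : Fin k → Fin n)
    (hidx : ∀ l : Fin k, idx l ≠ i) :
    rdet (A.updateRow i (fun j => ∑ l : Fin k, c l * A (idx l) j)) i = 0 ∧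
    cdet (A.updateRow i (fun j => ∑ l : Fin k, c l * A (idx l) j)) i = 0 := by
  rw [rdet_updateRow_eq_sum hA, cdet_updateRow_eq_sum hA, and_self]
  simp only [Finset.sum_mul, Finset.smul_sum, mul_assoc]
  rw [Finset.sum_comm]
  refine Finset.sum_eq_zero fun l _ => ?_
  have h := congrArg (c l * ·) (sum_sign_smul_othersRe_smul_eq_zero hA (hidx l))
  simpa only [Finset.mul_sum, mul_zero, mul_smul_comm] using h
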